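/- Let (α_z)_{z∈ℂ} be an analytic one-parameter group on A relative to φ. Then the group law extends to the whole complex plane: for all y, z ∈ ℂ one has α_{y+z} = α_y ∘ α_z. -/

import Mathlib

open scoped ComplexOrder

/-- An analytic one-parameter group on a (not necessarily unital) complex `*`-algebra `A`,
relative to a linear functional `φ` : a family `(α z)_{z ∈ ℂ}` of algebra homomorphisms
`A → A` such that each `α t` (`t` real) is a `*`-automorphism, the real group law holds,
each real `α t` scales `φ` by a strictly positive constant, and all the functions
`z ↦ φ (b * α z a)` and `z ↦ φ (α z a * b)` are entire. -/
structure AnalyticOneParamGroup {A : Type*} [NonUnitalRing A] [Module ℂ A]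
    [SMulCommClass ℂ A A] [IsScalarTower ℂ A A] [StarRing A] [StarModule ℂ A]
    (φ : A →ₗ[ℂ] ℂ) (α : ℂ → A → A) : Prop where
  map_add : ∀ (z : ℂ) (a b : A), α z (a + b) = α z a + α z b
  map_smul : ∀ (z : ℂ) (c : ℂ) (a : A), α z (c • a) = c • α z a
  map_mul : ∀ (z : ℂ) (a b : A), α z (a * b) = α z a * α z b
  real_star : ∀ (t : ℝ) (a : A), α (t : ℂ) (star a) = star (α (t : ℂ) a)
  real_bijective : ∀ t : ℝ, Function.Bijective (α (t : ℂ))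
  real_group : ∀ (s t : ℝ) (a : A), α ((s : ℂ) + (t : ℂ)) a = α (s : ℂ) (α (t : ℂ) a)
  real_rel_invariant : ∀ t : ℝ, ∃ c : ℝ, 0 < c ∧ ∀ a : A, φ (α (t : ℂ) a) = (c : ℂ) * φ a
  entire_left : ∀ a b : A, Differentiable ℂ fun z : ℂ => φ (b * α z a)
  entire_right : ∀ a b : A, Differentiable ℂ fun z : ℂ => φ (α z a * b)

/-- Two entire functions that agree on the real line are equal. -/
theorem Differentiable.eq_of_forall_ofReal_eq {f g : ℂ → ℂ} (hf : Differentiable ℂ f)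
    (hg : Differentiable ℂ g) (h : ∀ t : ℝ, f t = g t) : f = g := by
  have hf' : AnalyticOnNhd ℂ f Set.univ := fun z _ => hf.analyticAt z
  have hg' : AnalyticOnNhd ℂ g Set.univ := fun z _ => hg.analyticAt z
  refine hf'.eq_of_frequently_eq hg' (z₀ := 0) ?_
  have htend : Filter.Tendsto (fun t : ℝ => (t : ℂ)) (nhdsWithin 0 {0}ᶜ)
      (nhdsWithin 0 {0}ᶜ) := by
    refine tendsto_nhdsWithin_iff.2 ⟨?_, ?_⟩
    · exact (Complex.continuous_ofReal.tendsto' 0 0 Complex.ofReal_zero).mono_left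
        nhdsWithin_le_nhds
    · filter_upwards [self_mem_nhdsWithin] with t ht
      simpa using ht
  exact htend.frequently (Filter.Eventually.of_forall h).frequently

/-- For a faithful functional, the functionals `b ↦ φ (b * a)` separate points. -/
theorem LinearMap.eq_of_forall_mul_left_eq {A : Type*} [NonUnitalRing A] [Module ℂ A]
    [Star A] {φ : A →ₗ[ℂ] ℂ} (hfaith : ∀ a : A, φ (star a * a) = 0 → a = 0) {x y : A}
    (h : ∀ b : A, φ (b * x) = φ (b * y)) : x = y := by
  refine sub_eq_zero.1 (hfaith _ ?_)
  rw [mul_sub, map_sub, h, sub_self]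

/-- The group law holds when the outer parameter is real. -/
theorem AnalyticOneParamGroup.ofReal_add {A : Type*} [NonUnitalRing A] [Module ℂ A]
    [SMulCommClass ℂ A A] [IsScalarTower ℂ A A] [StarRing A] [StarModule ℂ A]
    {φ : A →ₗ[ℂ] ℂ} (hfaith : ∀ a : A, φ (star a * a) = 0 → a = 0)
    {α : ℂ → A → A} (hα : AnalyticOneParamGroup φ α) (t : ℝ) (z : ℂ) (a : A) :
    α (t + z) a = α t (α z a) := by
  refine LinearMap.eq_of_forall_mul_left_eq hfaith fun b => ?_
  obtain ⟨b, rfl⟩ := (hα.real_bijective t).2 b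
  obtain ⟨c, -, hc⟩ := hα.real_rel_invariant t
  have hl : Differentiable ℂ fun w : ℂ => φ (α t b * α (t + w) a) :=
    (hα.entire_left a (α t b)).comp (differentiable_id.const_add (t : ℂ))
  have hr : Differentiable ℂ fun w : ℂ => φ (α t b * α t (α w a)) := by
    simp only [← hα.map_mul, hc]
    exact (hα.entire_left a b).const_mul (c : ℂ)
  exact congrFun (hl.eq_of_forall_ofReal_eq hr fun s => by simp only [hα.real_group]) z

/-- The group law of an analytic one-parameter group extends to all complex parameters:
`α (y + z) = α y ∘ α z` for all `y z : ℂ`. -/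
theorem analyticOneParamGroup_group {A : Type*} [NonUnitalRing A] [Module ℂ A]
    [SMulCommClass ℂ A A] [IsScalarTower ℂ A A] [StarRing A] [StarModule ℂ A]
    (φ : A →ₗ[ℂ] ℂ)
    (hpos : ∀ a : A, 0 ≤ φ (star a * a))
    (hfaith : ∀ a : A, φ (star a * a) = 0 → a = 0)
    (α : ℂ → A → A) (hα : AnalyticOneParamGroup φ α)
    (y z : ℂ) :
    α (y + z) = α y ∘ α z := by
  funext a
  refine LinearMap.eq_of_forall_mul_left_eq hfaith fun b => ?_
  have hl : Differentiable ℂ fun w : ℂ => φ (b * α (w + z) a) :=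
    (hα.entire_left a b).comp (differentiable_id.add_const z)
  exact congrFun (hl.eq_of_forall_ofReal_eq (hα.entire_left (α z a) b)
    fun t => by simp only [hα.ofReal_add hfaith]) y
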